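/- arXiv:1403.3621 — 3 statements merged into one kernel-verified Lean document; each statement's English description precedes it below -/
import Mathlib

section
/- Let K be a field. Let π̄ and π be distinct planes (3-dimensional subspaces of K⁴) in the projective 3-space ℙ K (Fin 4 → K), and let O be a point lying on neither π̄ nor π. Let P̄ Q̄ R̄ S̄ be a quadrangle all of whose vertices lie on π̄, and let P Q R S be a quadrangle all of whose vertices lie on π. Suppose the two quadrangles are perspective from O. Then the diagonal triangles are perspective from O: for every point Ā collinear with S̄, P̄ and collinear with Q̄, R̄, and every point A collinear with S, P and collinear with Q, R, the triple (O, Ā, A) is collinear; likewise, for every B̄ collinear with S̄, Q̄ and with R̄, P̄ and B collinear with S, Q and with R, P, the triple (O, B̄, B) is collinear; and for every C̄ collinear with S̄, R̄ and with P̄, Q̄ and C collinear with S, R and with P, Q, the triple (O, C̄, C) is collinear. -/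
open Projectivization

/-- Three points of projective 3-space are collinear if their representative
vectors are linearly dependent. -/
def Col (K : Type*) [Field K] (a b c : Projectivization K (Fin 4 → K)) : Prop :=
  ¬ Projectivization.Independent ![a, b, c]

/-- A quadrangle: four points, no three of which are collinear. -/
def IsQuadrangle (K : Type*) [Field K] (P Q R S : Projectivization K (Fin 4 → K)) : Prop :=
  ¬ Col K P Q R ∧ ¬ Col K P Q S ∧ ¬ Col K P R S ∧ ¬ Col K Q R S

theorem col_iff {K : Type*} [Field K] (a b c : Projectivization K (Fin 4 → K)) :
    Col K a b c ↔ ∃ x y z : K, x • a.rep + y • b.rep + z • c.rep = 0 ∧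
      ¬ (x = 0 ∧ y = 0 ∧ z = 0) := by
  unfold Col
  rw [Projectivization.independent_iff, Fintype.not_linearIndependent_iff]
  constructor
  · rintro ⟨g, hg, i, hi⟩
    refine ⟨g 0, g 1, g 2, ?_, ?_⟩
    · simpa [Fin.sum_univ_three] using hg
    · rintro ⟨h0, h1, h2⟩
      fin_cases i <;> simp_all
  · rintro ⟨x, y, z, h, hn⟩
    refine ⟨![x, y, z], ?_, ?_⟩
    · simpa [Fin.sum_univ_three] using h
    · by_contra hc
      push Not at hc
      exact hn ⟨hc 0, hc 1, hc 2⟩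

theorem col_rot {K : Type*} [Field K] {a b c : Projectivization K (Fin 4 → K)}
    (h : Col K a b c) : Col K b c a := by
  rw [col_iff] at *
  obtain ⟨x, y, z, h, hn⟩ := h
  exact ⟨y, z, x, by rw [← h]; abel, by tauto⟩

theorem col_swap {K : Type*} [Field K] {a b c : Projectivization K (Fin 4 → K)}
    (h : Col K a b c) : Col K b a c := by
  rw [col_iff] at *
  obtain ⟨x, y, z, h, hn⟩ := h
  exact ⟨y, x, z, by rw [← h]; abel, by tauto⟩

theorem quad_rot {K : Type*} [Field K] {P Q R S : Projectivization K (Fin 4 → K)}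
    (h : IsQuadrangle K P Q R S) : IsQuadrangle K Q R P S := by
  obtain ⟨h1, h2, h3, h4⟩ := h
  exact ⟨fun h => h1 (col_rot (col_rot h)), h4, fun h => h2 (col_swap h),
    fun h => h3 (col_swap h)⟩

/-- If `b ≠ a` (witnessed by a noncollinear triple), a point on the line is a combination. -/
theorem col_comb {K : Type*} [Field K] {a b c : Projectivization K (Fin 4 → K)}
    (hab : ∀ x y : K, x • a.rep + y • b.rep = 0 → x = 0 ∧ y = 0)
    (h : Col K a b c) : ∃ x y : K, c.rep = x • a.rep + y • b.rep := by
  rw [col_iff] at h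
  obtain ⟨x, y, z, h, hn⟩ := h
  have hz : z ≠ 0 := by
    rintro rfl
    have := hab x y (by simpa using h)
    tauto
  refine ⟨-(z⁻¹ * x), -(z⁻¹ * y), ?_⟩
  have h2 : z⁻¹ • (x • a.rep + y • b.rep + z • c.rep) = 0 := by rw [h, smul_zero]
  simp only [smul_add, smul_smul, inv_mul_cancel₀ hz, one_smul] at h2
  rw [neg_smul, neg_smul, eq_comm, ← sub_eq_zero, ← neg_eq_zero, ← h2]
  abel

theorem ncol_pair {K : Type*} [Field K] {a b c : Projectivization K (Fin 4 → K)}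
    (h : ¬ Col K a b c) (x y : K) (hxy : x • a.rep + y • b.rep = 0) : x = 0 ∧ y = 0 := by
  by_contra hc
  exact h ((col_iff a b c).2 ⟨x, y, 0, by simpa using hxy, by tauto⟩)

theorem rep_mem_of_le {K : Type*} [Field K] {a : Projectivization K (Fin 4 → K)}
    {p : Submodule K (Fin 4 → K)} (h : a.submodule ≤ p) : a.rep ∈ p := by
  rw [Projectivization.submodule_eq] at h
  exact h (Submodule.mem_span_singleton_self _)

theorem rep_notMem {K : Type*} [Field K] {a : Projectivization K (Fin 4 → K)}
    {p : Submodule K (Fin 4 → K)} (h : ¬ a.submodule ≤ p) : a.rep ∉ p := by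
  rwa [Projectivization.submodule_eq, Submodule.span_singleton_le_iff_mem] at h

theorem smul_notMem {K : Type*} [Field K] {o : Fin 4 → K}
    {p : Submodule K (Fin 4 → K)} (h : o ∉ p) {x : K} (hx : x • o ∈ p) : x = 0 := by
  by_contra hc
  exact h ((Submodule.smul_mem_iff p hc).1 hx)

theorem out_pair {K : Type*} [Field K] {a b : Projectivization K (Fin 4 → K)}
    {p : Submodule K (Fin 4 → K)} (ha : a.rep ∉ p) (hb : b.rep ∈ p)
    (x y : K) (hxy : x • a.rep + y • b.rep = 0) : x = 0 ∧ y = 0 := by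
  have hx : x = 0 := by
    apply smul_notMem ha
    rw [eq_neg_of_add_eq_zero_left hxy]
    exact p.neg_mem (p.smul_mem _ hb)
  subst hx
  refine ⟨rfl, ?_⟩
  simpa [b.rep_nonzero] using hxy

theorem diag_one {K : Type*} [Field K]
    (p : Submodule K (Fin 4 → K))
    (O Pb Qb Rb Sb P Q R S : Projectivization K (Fin 4 → K))
    (hO : ¬ O.submodule ≤ p)
    (hq1 : IsQuadrangle K Pb Qb Rb Sb)
    (hq2 : IsQuadrangle K P Q R S)
    (hPb : Pb.submodule ≤ p) (hQb : Qb.submodule ≤ p)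
    (hRb : Rb.submodule ≤ p) (hSb : Sb.submodule ≤ p)
    (hperspP : Col K O Pb P) (hperspQ : Col K O Qb Q)
    (hperspR : Col K O Rb R) (hperspS : Col K O Sb S)
    (Ab A : Projectivization K (Fin 4 → K))
    (h1 : Col K Sb Pb Ab) (h2 : Col K Qb Rb Ab) (h3 : Col K S P A) (h4 : Col K Q R A) :
    Col K O Ab A := by
  have hO' := rep_notMem hO
  have mP := rep_mem_of_le hPb
  have mQ := rep_mem_of_le hQb
  have mR := rep_mem_of_le hRb
  have mS := rep_mem_of_le hSb
  obtain ⟨p1, p2, eP⟩ := col_comb (out_pair hO' mP) hperspP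
  obtain ⟨q1, q2, eQ⟩ := col_comb (out_pair hO' mQ) hperspQ
  obtain ⟨r1, r2, eR⟩ := col_comb (out_pair hO' mR) hperspR
  obtain ⟨s1, s2, eS⟩ := col_comb (out_pair hO' mS) hperspS
  obtain ⟨_, _, n1, n2⟩ := hq1
  obtain ⟨_, _, m1, m2⟩ := hq2
  obtain ⟨x1, y1, e1⟩ := col_comb
    (ncol_pair (c := Rb) fun h => n1 (col_rot h)) h1
  obtain ⟨z1, w1, e2⟩ := col_comb (ncol_pair n2) h2
  obtain ⟨x2, y2, e3⟩ := col_comb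
    (ncol_pair (c := R) fun h => m1 (col_rot h)) h3
  obtain ⟨z2, w2, e4⟩ := col_comb (ncol_pair m2) h4
  have hA0 := Ab.rep_nonzero
  have hind : ∀ x y z : K, x • Pb.rep + y • Rb.rep + z • Sb.rep = 0 → x = 0 ∧ y = 0 ∧ z = 0 := by
    intro x y z h
    by_contra hc
    exact n1 ((col_iff _ _ _).2 ⟨x, y, z, h, hc⟩)
  rw [col_iff]
  generalize O.rep = o at *
  generalize Pb.rep = vp at *
  generalize Qb.rep = vq at *
  generalize Rb.rep = vr at *
  generalize Sb.rep = vs at *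
  generalize Ab.rep = a at *
  generalize A.rep = a' at *
  rw [eP, eS] at e3
  rw [eQ, eR] at e4
  -- the o-coefficients agree
  have hl : (x2 * s1 + y2 * p1) - (z2 * q1 + w2 * r1) = 0 := by
    apply smul_notMem hO'
    have : ((x2 * s1 + y2 * p1) - (z2 * q1 + w2 * r1)) • o =
        (z2 * q2) • vq + (w2 * r2) • vr - ((x2 * s2) • vs + (y2 * p2) • vp) := by
      have h := e3.symm.trans e4
      rw [← sub_eq_zero] at h ⊢
      rw [← h]
      module
    rw [this]
    exact p.sub_mem (p.add_mem (p.smul_mem _ mQ) (p.smul_mem _ mR))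
      (p.add_mem (p.smul_mem _ mS) (p.smul_mem _ mP))
  -- the projected point
  obtain ⟨b, hb⟩ : ∃ b, b = (x2 * s2) • vs + (y2 * p2) • vp := ⟨_, rfl⟩
  have ha' : a' = (x2 * s1 + y2 * p1) • o + b := by
    rw [e3, hb]; module
  have hb2 : b = (z2 * q2) • vq + (w2 * r2) • vr := by
    have : b = a' - (x2 * s1 + y2 * p1) • o := by rw [ha']; abel
    rw [this, sub_eq_zero.1 hl, e4]; module
  generalize x2 * s2 = X at *
  generalize y2 * p2 = Y at *
  generalize z2 * q2 = Z at *
  generalize w2 * r2 = W at *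
  generalize x2 * s1 + y2 * p1 = L at *
  have key : Z • a = z1 • b := by
    have := hind (Z * y1 - z1 * Y) (-(Z * w1 - z1 * W)) (Z * x1 - z1 * X) (by
      have h1 : Z • a - z1 • b = Z • a - z1 • b := rfl
      conv_lhs at h1 => rw [e1, hb]
      conv_rhs at h1 => rw [e2, hb2]
      rw [← sub_eq_zero] at h1
      rw [← h1]; module)
    obtain ⟨u, _, v⟩ := this
    rw [← sub_eq_zero, e1, hb]
    have : Z • (x1 • vs + y1 • vp) - z1 • (X • vs + Y • vp) =
      (Z * x1 - z1 * X) • vs + (Z * y1 - z1 * Y) • vp := by module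
    rw [this, u, v]; simp
  by_cases hz : z1 = 0
  · subst hz
    have hZ : Z = 0 := by simpa [hA0] using key
    subst hZ
    have hw : w1 ≠ 0 := by
      rintro rfl
      exact hA0 (by rw [e2]; simp)
    refine ⟨w1 * L, W, -w1, ?_, fun h => hw (neg_eq_zero.1 h.2.2)⟩
    rw [ha', hb2, e2]; module
  · refine ⟨z1 * L, Z, -z1, ?_, fun h => hz (neg_eq_zero.1 h.2.2)⟩
    rw [ha', key]; module

theorem perspective_quadrangles_diagonal_triangles_perspective
    {K : Type*} [Field K]
    (πb π : Submodule K (Fin 4 → K))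
    (hπb3 : Module.finrank K πb = 3) (hπ3 : Module.finrank K π = 3)
    (hplanes : πb ≠ π)
    (O Pb Qb Rb Sb P Q R S : Projectivization K (Fin 4 → K))
    (hOπb : ¬ O.submodule ≤ πb) (hOπ : ¬ O.submodule ≤ π)
    (hq1 : IsQuadrangle K Pb Qb Rb Sb)
    (hq2 : IsQuadrangle K P Q R S)
    (hPb : Pb.submodule ≤ πb) (hQb : Qb.submodule ≤ πb)
    (hRb : Rb.submodule ≤ πb) (hSb : Sb.submodule ≤ πb)
    (hP : P.submodule ≤ π) (hQ : Q.submodule ≤ π)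
    (hR : R.submodule ≤ π) (hS : S.submodule ≤ π)
    (hperspP : Col K O Pb P) (hperspQ : Col K O Qb Q)
    (hperspR : Col K O Rb R) (hperspS : Col K O Sb S) :
    (∀ Ab A : Projectivization K (Fin 4 → K),
      Col K Sb Pb Ab → Col K Qb Rb Ab → Col K S P A → Col K Q R A →
      Col K O Ab A) ∧
    (∀ Bb B : Projectivization K (Fin 4 → K),
      Col K Sb Qb Bb → Col K Rb Pb Bb → Col K S Q B → Col K R P B →
      Col K O Bb B) ∧
    (∀ Cb C : Projectivization K (Fin 4 → K),
      Col K Sb Rb Cb → Col K Pb Qb Cb → Col K S R C → Col K P Q C →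
      Col K O Cb C) := by
  have k1 := quad_rot hq1
  have k2 := quad_rot hq2
  refine ⟨?_, ?_, ?_⟩
  · exact diag_one πb O Pb Qb Rb Sb P Q R S hOπb hq1 hq2 hPb hQb hRb hSb
      hperspP hperspQ hperspR hperspS
  · exact diag_one πb O Qb Rb Pb Sb Q R P S hOπb k1 k2 hQb hRb hPb hSb
      hperspQ hperspR hperspP hperspS
  · exact diag_one πb O Rb Pb Qb Sb R P Q S hOπb (quad_rot k1) (quad_rot k2) hRb hPb hQb hSb
      hperspR hperspP hperspQ hperspS
end

section
/- Let K be a field and let π be a plane (3-dimensional subspace of K⁴) in the projective 3-space ℙ K (Fin 4 → K). Let P₁ Q₁ R₁ S₁ and P₂ Q₂ R₂ S₂ be quadrangles all of whose vertices lie on π, perspective from a point O lying on π, and suppose the lines P₁Q₁ and P₂Q₂ are distinct and the lines R₁S₁ and R₂S₂ are distinct. Let C₁ be collinear with S₁, R₁ and with P₁, Q₁, and C₂ collinear with S₂, R₂ and with P₂, Q₂, and suppose (O, C₁, C₂) is collinear. Let O₁ ≠ O₂ be points not lying on π with (O, O₁, O₂) collinear. Let P̄, Q̄, R̄, S̄,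 C̄ be points, each distinct from O₁ and from O₂, such that (O₁, P₁, P̄) and (O₂, P₂, P̄) are collinear, (O₁, Q₁, Q̄) and (O₂, Q₂, Q̄) are collinear, (O₁, R₁, R̄) and (O₂, R₂, R̄) are collinear, (O₁, S₁, S̄) and (O₂, S₂, S̄) are collinear, and (O₁, C₁, C̄) and (O₂, C₂, C̄) are collinear. Then (P̄, Q̄, C̄) is collinear, (R̄, S̄, C̄) is collinear, and consequently there exists a plane containing all four points P̄, Q̄, R̄, S̄. -/
open Projectivization

/-- The line through two points, as a submodule of `K⁴`. -/
def line {K : Type*} [Field K] (a b : Projectivization K (Fin 4 → K)) :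
    Submodule K (Fin 4 → K) :=
  a.submodule ⊔ b.submodule

section helpers
variable {K : Type*} [Field K]

theorem aux_col_le {a b c : Projectivization K (Fin 4 → K)} (hab : a ≠ b) (h : Col K a b c) :
    c.submodule ≤ a.submodule ⊔ b.submodule := by
  unfold Col at h
  rw [Projectivization.independent_iff] at h
  have h2 : LinearIndependent K ![a.rep, b.rep] := by
    have := (Projectivization.independent_pair_iff_ne a b).2 hab
    rw [Projectivization.independent_iff] at this
    convert! this using 1
    ext i; fin_cases i <;> rfl
  rw [Projectivization.submodule_eq a, Projectivization.submodule_eq b,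
    Projectivization.submodule_eq c, Submodule.span_singleton_le_iff_mem]
  by_contra hc
  apply h
  have h3 : LinearIndependent K (Fin.snoc ![a.rep, b.rep] c.rep : Fin 3 → (Fin 4 → K)) := by
    rw [linearIndependent_finSnoc]
    refine ⟨h2, fun hm => hc ?_⟩
    rw [← Submodule.span_union]
    convert hm using 2
    ext x; simp [or_comm, eq_comm]
  convert! h3 using 1
  ext i; fin_cases i <;> rfl

theorem aux_col_of {a b c : Projectivization K (Fin 4 → K)} (M : Submodule K (Fin 4 → K))
    (hM : Module.finrank K M ≤ 2) (ha : a.submodule ≤ M) (hb : b.submodule ≤ M)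
    (hc : c.submodule ≤ M) : Col K a b c := by
  intro h
  rw [Projectivization.independent_iff] at h
  rw [Projectivization.submodule_eq, Submodule.span_singleton_le_iff_mem] at ha hb hc
  have := finrank_span_eq_card h
  have h2 : Submodule.span K (Set.range (Projectivization.rep ∘ ![a, b, c])) ≤ M := by
    rw [Submodule.span_le]
    rintro _ ⟨i, rfl⟩
    fin_cases i <;> assumption
  have := Submodule.finrank_mono h2
  simp at *
  omega

theorem aux_ne {a b c : Projectivization K (Fin 4 → K)} (h : ¬ Col K a b c) : a ≠ b ∧ b ≠ c := by
  unfold Col at h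
  rw [not_not, Projectivization.independent_iff] at h
  constructor
  · rintro rfl
    exact absurd (h.injective (a₁ := 0) (a₂ := 1) rfl) (by decide)
  · rintro rfl
    exact absurd (h.injective (a₁ := 1) (a₂ := 2) rfl) (by decide)

theorem aux_finrank (a : Projectivization K (Fin 4 → K)) : Module.finrank K a.submodule = 1 :=
  a.finrank_submodule

theorem aux_inf {π : Submodule K (Fin 4 → K)} {O : Projectivization K (Fin 4 → K)}
    (hO : ¬ O.submodule ≤ π) {l : Submodule K (Fin 4 → K)} (hl : l ≤ π) :
    (l ⊔ O.submodule) ⊓ π = l := by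
  rw [sup_inf_assoc_of_le _ hl]
  have : O.submodule ⊓ π = ⊥ := by
    rw [Projectivization.submodule_eq, Submodule.span_singleton_le_iff_mem] at hO
    rw [Projectivization.submodule_eq, ← disjoint_iff]
    exact (Submodule.disjoint_span_singleton_of_notMem hO).symm
  rw [this, sup_bot_eq]

theorem aux_line {a b : Projectivization K (Fin 4 → K)} : Module.finrank K (line a b) ≤ 2 := by
  have := Submodule.finrank_add_le_finrank_add_finrank a.submodule b.submodule
  rw [aux_finrank, aux_finrank] at this
  exact this

theorem aux_rank {π l₁ l₂ : Submodule K (Fin 4 → K)} {O₁ O₂ : Projectivization K (Fin 4 → K)}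
    (hO₁ : ¬ O₁.submodule ≤ π) (hO₂ : ¬ O₂.submodule ≤ π) (h₁ : l₁ ≤ π) (h₂ : l₂ ≤ π)
    (hl₁ : Module.finrank K l₁ ≤ 2) (hl₂ : Module.finrank K l₂ ≤ 2) (hne : l₁ ≠ l₂) :
    Module.finrank K ((l₁ ⊔ O₁.submodule) ⊓ (l₂ ⊔ O₂.submodule) : Submodule K (Fin 4 → K)) ≤ 2 := by
  by_contra hc
  push Not at hc
  have e₁ := Submodule.finrank_add_le_finrank_add_finrank l₁ O₁.submodule
  have e₂ := Submodule.finrank_add_le_finrank_add_finrank l₂ O₂.submodule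
  rw [aux_finrank] at e₁ e₂
  have f₁ := Submodule.eq_of_le_of_finrank_le
    (inf_le_left : (l₁ ⊔ O₁.submodule) ⊓ (l₂ ⊔ O₂.submodule) ≤ _) (by omega)
  have f₂ := Submodule.eq_of_le_of_finrank_le
    (inf_le_right : (l₁ ⊔ O₁.submodule) ⊓ (l₂ ⊔ O₂.submodule) ≤ _) (by omega)
  apply hne
  rw [← aux_inf hO₁ h₁, ← aux_inf hO₂ h₂, ← f₁, f₂]

theorem aux_lift {π l : Submodule K (Fin 4 → K)} {O P B : Projectivization K (Fin 4 → K)}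
    (hO : ¬ O.submodule ≤ π) (hl : l ≤ π) (hP : P.submodule ≤ l) (h : Col K O P B) :
    B.submodule ≤ l ⊔ O.submodule := by
  have : O ≠ P := by
    rintro rfl
    exact hO (hP.trans hl)
  refine (aux_col_le this h).trans (sup_le le_sup_right (hP.trans le_sup_left))

theorem aux_plane (M : Submodule K (Fin 4 → K)) (hM : Module.finrank K M ≤ 3) :
    ∃ N : Submodule K (Fin 4 → K), Module.finrank K N = 3 ∧ M ≤ N := by
  have hlt : M < ⊤ := by
    rw [lt_top_iff_ne_top]
    rintro rfl
    simp at hM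
  obtain ⟨f, hf, hle⟩ := M.exists_le_ker_of_lt_top hlt
  refine ⟨LinearMap.ker f, ?_, hle⟩
  have := Module.Dual.finrank_ker_add_one_of_ne_zero (f := f) hf
  simp at this
  omega

end helpers

theorem lifted_quadrangle_is_planar
    {K : Type*} [Field K]
    (π : Submodule K (Fin 4 → K)) (hπ3 : Module.finrank K π = 3)
    (O P₁ Q₁ R₁ S₁ P₂ Q₂ R₂ S₂ : Projectivization K (Fin 4 → K))
    (hO : O.submodule ≤ π)
    (hq1 : IsQuadrangle K P₁ Q₁ R₁ S₁)
    (hq2 : IsQuadrangle K P₂ Q₂ R₂ S₂)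
    (hP₁ : P₁.submodule ≤ π) (hQ₁ : Q₁.submodule ≤ π)
    (hR₁ : R₁.submodule ≤ π) (hS₁ : S₁.submodule ≤ π)
    (hP₂ : P₂.submodule ≤ π) (hQ₂ : Q₂.submodule ≤ π)
    (hR₂ : R₂.submodule ≤ π) (hS₂ : S₂.submodule ≤ π)
    (hperspP : Col K O P₁ P₂) (hperspQ : Col K O Q₁ Q₂)
    (hperspR : Col K O R₁ R₂) (hperspS : Col K O S₁ S₂)
    (hPQ : line P₁ Q₁ ≠ line P₂ Q₂) (hRS : line R₁ S₁ ≠ line R₂ S₂)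
    (C₁ C₂ : Projectivization K (Fin 4 → K))
    (hC₁SR : Col K S₁ R₁ C₁) (hC₁PQ : Col K P₁ Q₁ C₁)
    (hC₂SR : Col K S₂ R₂ C₂) (hC₂PQ : Col K P₂ Q₂ C₂)
    (hOC : Col K O C₁ C₂)
    (O₁ O₂ : Projectivization K (Fin 4 → K))
    (hO₁O₂ : O₁ ≠ O₂)
    (hO₁π : ¬ O₁.submodule ≤ π) (hO₂π : ¬ O₂.submodule ≤ π)
    (hOO₁O₂ : Col K O O₁ O₂)
    (Pb Qb Rb Sb Cb : Projectivization K (Fin 4 → K))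
    (hPbO₁ : Pb ≠ O₁) (hPbO₂ : Pb ≠ O₂)
    (hQbO₁ : Qb ≠ O₁) (hQbO₂ : Qb ≠ O₂)
    (hRbO₁ : Rb ≠ O₁) (hRbO₂ : Rb ≠ O₂)
    (hSbO₁ : Sb ≠ O₁) (hSbO₂ : Sb ≠ O₂)
    (hCbO₁ : Cb ≠ O₁) (hCbO₂ : Cb ≠ O₂)
    (hPb₁ : Col K O₁ P₁ Pb) (hPb₂ : Col K O₂ P₂ Pb)
    (hQb₁ : Col K O₁ Q₁ Qb) (hQb₂ : Col K O₂ Q₂ Qb)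
    (hRb₁ : Col K O₁ R₁ Rb) (hRb₂ : Col K O₂ R₂ Rb)
    (hSb₁ : Col K O₁ S₁ Sb) (hSb₂ : Col K O₂ S₂ Sb)
    (hCb₁ : Col K O₁ C₁ Cb) (hCb₂ : Col K O₂ C₂ Cb) :
    Col K Pb Qb Cb ∧ Col K Rb Sb Cb ∧
    ∃ πb : Submodule K (Fin 4 → K), Module.finrank K πb = 3 ∧
      Pb.submodule ≤ πb ∧ Qb.submodule ≤ πb ∧ Rb.submodule ≤ πb ∧ Sb.submodule ≤ πb := by
  have nPQ₁ := (aux_ne hq1.1).1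
  have nPQ₂ := (aux_ne hq2.1).1
  have nRS₁ := (aux_ne hq1.2.2.1).2.symm
  have nRS₂ := (aux_ne hq2.2.2.1).2.symm
  have c1 := aux_col_le nPQ₁ hC₁PQ
  have c2 := aux_col_le nPQ₂ hC₂PQ
  have d1 := aux_col_le nRS₁ hC₁SR
  have d2 := aux_col_le nRS₂ hC₂SR
  rw [sup_comm] at d1 d2
  have l1 : line P₁ Q₁ ≤ π := sup_le hP₁ hQ₁
  have l2 : line P₂ Q₂ ≤ π := sup_le hP₂ hQ₂
  have k1 : line R₁ S₁ ≤ π := sup_le hR₁ hS₁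
  have k2 : line R₂ S₂ ≤ π := sup_le hR₂ hS₂
  have r1 := aux_rank hO₁π hO₂π l1 l2 aux_line aux_line hPQ
  have r2 := aux_rank hO₁π hO₂π k1 k2 aux_line aux_line hRS
  have mP := le_inf (aux_lift hO₁π l1 le_sup_left hPb₁) (aux_lift hO₂π l2 le_sup_left hPb₂)
  have mQ := le_inf (aux_lift hO₁π l1 le_sup_right hQb₁) (aux_lift hO₂π l2 le_sup_right hQb₂)
  have mC := le_inf (aux_lift hO₁π l1 c1 hCb₁) (aux_lift hO₂π l2 c2 hCb₂)
  have mR := le_inf (aux_lift hO₁π k1 le_sup_left hRb₁) (aux_lift hO₂π k2 le_sup_left hRb₂)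
  have mS := le_inf (aux_lift hO₁π k1 le_sup_right hSb₁) (aux_lift hO₂π k2 le_sup_right hSb₂)
  have mD := le_inf (aux_lift hO₁π k1 d1 hCb₁) (aux_lift hO₂π k2 d2 hCb₂)
  refine ⟨aux_col_of _ r1 mP mQ mC, aux_col_of _ r2 mR mS mD, ?_⟩
  have hs := Submodule.finrank_sup_add_finrank_inf_eq
    ((line P₁ Q₁ ⊔ O₁.submodule) ⊓ (line P₂ Q₂ ⊔ O₂.submodule))
    ((line R₁ S₁ ⊔ O₁.submodule) ⊓ (line R₂ S₂ ⊔ O₂.submodule))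
  have hi := Submodule.finrank_mono (le_inf mC mD)
  rw [aux_finrank] at hi
  obtain ⟨N, hN, hle⟩ := aux_plane
    (((line P₁ Q₁ ⊔ O₁.submodule) ⊓ (line P₂ Q₂ ⊔ O₂.submodule)) ⊔
    ((line R₁ S₁ ⊔ O₁.submodule) ⊓ (line R₂ S₂ ⊔ O₂.submodule))) (by omega)
  exact ⟨N, hN, mP.trans (le_sup_left.trans hle), mQ.trans (le_sup_left.trans hle),
    mR.trans (le_sup_right.trans hle), mS.trans (le_sup_right.trans hle)⟩
end

section
/- Let K be a field, let π be a plane (3-dimensional subspace of K⁴) in the projective 3-space ℙ K (Fin 4 → K), and let O₁ be a point not lying on π. Let P₁, Q₁, R₁ be points on π that are not collinear. Let P̄, Q̄, R̄ be points, each distinct from O₁, such that (O₁, P₁, P̄), (O₁, Q₁, Q̄) and (O₁, R₁, R̄) are each collinear triples. Then P̄, Q̄, R̄ are not collinear. -/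
open Projectivization

theorem indep3_iff {K : Type*} [Field K] (a b c : Projectivization K (Fin 4 → K)) :
    Projectivization.Independent ![a, b, c] ↔
      ∀ x y z : K, x • a.rep + y • b.rep + z • c.rep = 0 → x = 0 ∧ y = 0 ∧ z = 0 := by
  rw [Projectivization.independent_iff, Fintype.linearIndependent_iff]
  constructor
  · intro h x y z e
    have := h ![x, y, z] (by simpa [Fin.sum_univ_three] using e)
    exact ⟨this 0, this 1, this 2⟩
  · intro h g e
    obtain ⟨h0, h1, h2⟩ := h (g 0) (g 1) (g 2) (by simpa [Fin.sum_univ_three] using e)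
    intro i
    fin_cases i
    · exact h0
    · exact h1
    · exact h2

theorem rep_mem_iff {K : Type*} [Field K] (π : Submodule K (Fin 4 → K))
    (a : Projectivization K (Fin 4 → K)) : a.submodule ≤ π ↔ a.rep ∈ π := by
  rw [Projectivization.submodule_eq, Submodule.span_singleton_le_iff_mem]

theorem coeff_zero {K : Type*} [Field K] {π : Submodule K (Fin 4 → K)} {o v : Fin 4 → K}
    (ho : o ∉ π) (hv : v ∈ π) {s : K} (e : s • o + v = 0) : s = 0 := by
  by_contra hs
  apply ho
  rw [← Submodule.smul_mem_iff π hs, eq_neg_of_add_eq_zero_left e]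
  exact π.neg_mem hv

theorem col_decomp {K : Type*} [Field K] {π : Submodule K (Fin 4 → K)}
    {o p q : Projectivization K (Fin 4 → K)} (ho : o.rep ∉ π) (hp : p.rep ∈ π)
    (hq : q ≠ o) (h : Col K o p q) :
    ∃ a b : K, b ≠ 0 ∧ q.rep = a • o.rep + b • p.rep := by
  unfold Col at h
  rw [indep3_iff] at h
  push Not at h
  obtain ⟨x, y, z, e, hne⟩ := h
  have hz : z ≠ 0 := by
    rintro rfl
    rw [zero_smul, add_zero] at e
    have hx := coeff_zero ho (π.smul_mem y hp) e
    subst hx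
    rw [zero_smul, zero_add] at e
    exact hne rfl ((smul_eq_zero.mp e).resolve_right p.rep_nonzero) rfl
  have e2 : q.rep = (-(z⁻¹ * x)) • o.rep + (-(z⁻¹ * y)) • p.rep := by
    have h1 : z⁻¹ • (x • o.rep + y • p.rep + z • q.rep) = 0 := by rw [e, smul_zero]
    rw [smul_add, smul_add, smul_smul, smul_smul, smul_smul, inv_mul_cancel₀ hz, one_smul] at h1
    rw [eq_neg_of_add_eq_zero_right h1]
    module
  refine ⟨_, _, ?_, e2⟩
  intro hb
  rw [hb, zero_smul, add_zero] at e2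
  apply hq
  rw [← q.mk_rep, ← o.mk_rep, Projectivization.mk_eq_mk_iff']
  exact ⟨_, e2.symm⟩

theorem projection_preserves_noncollinearity
    {K : Type*} [Field K]
    (π : Submodule K (Fin 4 → K)) (hπ3 : Module.finrank K π = 3)
    (O₁ P₁ Q₁ R₁ Pb Qb Rb : Projectivization K (Fin 4 → K))
    (hO₁π : ¬ O₁.submodule ≤ π)
    (hP₁ : P₁.submodule ≤ π) (hQ₁ : Q₁.submodule ≤ π) (hR₁ : R₁.submodule ≤ π)
    (hncol : ¬ Col K P₁ Q₁ R₁)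
    (hPbO₁ : Pb ≠ O₁) (hQbO₁ : Qb ≠ O₁) (hRbO₁ : Rb ≠ O₁)
    (hPb : Col K O₁ P₁ Pb) (hQb : Col K O₁ Q₁ Qb) (hRb : Col K O₁ R₁ Rb) :
    ¬ Col K Pb Qb Rb := by
  rw [rep_mem_iff] at hO₁π hP₁ hQ₁ hR₁
  obtain ⟨a, a', ha, ea⟩ := col_decomp hO₁π hP₁ hPbO₁ hPb
  obtain ⟨b, b', hb, eb⟩ := col_decomp hO₁π hQ₁ hQbO₁ hQb
  obtain ⟨c, c', hc, ec⟩ := col_decomp hO₁π hR₁ hRbO₁ hRb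
  unfold Col at hncol ⊢
  rw [not_not, indep3_iff] at hncol ⊢
  intro x y z e
  rw [ea, eb, ec] at e
  have e' : (x * a + y * b + z * c) • O₁.rep +
      ((x * a') • P₁.rep + (y * b') • Q₁.rep + (z * c') • R₁.rep) = 0 := by
    rw [← e]; module
  have h0 := coeff_zero hO₁π (π.add_mem (π.add_mem (π.smul_mem _ hP₁) (π.smul_mem _ hQ₁))
    (π.smul_mem _ hR₁)) e'
  rw [h0, zero_smul, zero_add] at e'
  obtain ⟨h1, h2, h3⟩ := hncol _ _ _ e'
  exact ⟨(mul_eq_zero.mp h1).resolve_right ha, (mul_eq_zero.mp h2).resolve_right hb,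
    (mul_eq_zero.mp h3).resolve_right hc⟩
end
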